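/- arXiv:1509.00460 — 2 statements merged into one kernel-verified Lean document; each statement's English description precedes it below -/
import Mathlib

section
/- Let p, n ≥ 1 be integers, let a ∈ ℝ^d and let ℛ = [a₁, a₁+p) × ⋯ × [a_d, a_d+p). For ν = 1, …, n let P_ν be a trigonometric polynomial on 𝕋^d whose frequencies lie in ℛ ∩ ℤ^d (i.e., P_ν is a finite linear combination of x ↦ e^{2πi⟨k,x⟩} with k ∈ ℛ ∩ ℤ^d), let f_ν ∈ C^∞(𝕋^d), and let G_ν = Per_p f_ν be its p-periodization. Then (G₁P₁) * ⋯ * (G_nP_n) = (G₁ * ⋯ * G_n) · (P₁ * ⋯ * P_n). -/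
open MeasureTheory
open scoped ENNReal

/-- The `d`-dimensional torus `𝕋^d = (ℝ/ℤ)^d`. -/
abbrev Torus (d : ℕ) := Fin d → AddCircle (1 : ℝ)

/-- Convolution of functions on `𝕋^d` with respect to the probability Haar measure. -/
noncomputable def tconv {d : ℕ} (f g : Torus d → ℂ) : Torus d → ℂ :=
  fun x => ∫ y, f (x - y) * g y

/-- Iterated convolution `F 0 * F 1 * ⋯ * F n` of `n+1` functions on `𝕋^d`. -/
noncomputable def tconvFold {d : ℕ} : (n : ℕ) → (Fin (n + 1) → Torus d → ℂ) → Torus d → ℂ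
  | 0, F => F 0
  | n + 1, F => tconv (F 0) (tconvFold n (fun i => F i.succ))

/-- The `p`-periodization of `f : 𝕋^d → ℂ`: the unique function which is `1/p`-periodic in
each coordinate and agrees with `t ↦ f(pt)` on `[0,1/p)^d`; concretely `x ↦ f (p • x)`. -/
noncomputable def perz {d : ℕ} (p : ℕ) (f : Torus d → ℂ) : Torus d → ℂ :=
  fun x => f (fun i => p • x i)

/-- `f ∈ C^∞(𝕋^d)`: the lift of `f` to `ℝ^d` is smooth. -/
def TSmooth {d : ℕ} (f : Torus d → ℂ) : Prop :=
  ContDiff ℝ (⊤ : ℕ∞) (fun v : Fin d → ℝ => f (fun i => ((v i : ℝ) : AddCircle (1 : ℝ))))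

/-- The character `x ↦ e^{2πi⟨k,x⟩}` of the torus. -/
noncomputable def torusChar {d : ℕ} (k : Fin d → ℤ) (x : Torus d) : ℂ :=
  ∏ i, fourier (k i) (x i)

/-- `G` is `1/p`-periodic in each coordinate: it is invariant under the `p`-torsion. -/
def TorsionInvariant {d : ℕ} (p : ℕ) (G : Torus d → ℂ) : Prop :=
  ∀ t : Torus d, p • t = 0 → ∀ x, G (x + t) = G x

section torusChar

variable {d : ℕ} (k l : Fin d → ℤ) (x y : Torus d)

lemma continuous_torusChar : Continuous (torusChar k) := by
  unfold torusChar
  fun_prop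

lemma torusChar_add_right : torusChar k (x + y) = torusChar k x * torusChar k y := by
  simp [torusChar, ← Finset.prod_mul_distrib, fourier_apply, AddCircle.toCircle_add, smul_add]

lemma torusChar_sub_mul :
    torusChar k (x - y) * torusChar l y = torusChar k x * torusChar (l - k) y := by
  simp only [torusChar, ← Finset.prod_mul_distrib]
  refine Finset.prod_congr rfl fun i _ => ?_
  simp only [fourier_apply, Pi.sub_apply, ← Circle.coe_mul, ← AddCircle.toCircle_add]
  congr 2
  rw [smul_sub, sub_smul]
  abel

end torusChar

lemma exists_torsion_torusChar_ne_one {d p : ℕ} (hp : 1 ≤ p) {m : Fin d → ℤ} {i : Fin d}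
    (hm : ¬ (p : ℤ) ∣ m i) : ∃ t : Torus d, p • t = 0 ∧ torusChar m t ≠ 1 := by
  have hp' : (p : ℝ) ≠ 0 := by positivity
  refine ⟨Pi.single i (((1 : ℝ) / p : ℝ) : AddCircle (1 : ℝ)), ?_, ?_⟩
  · rw [← Pi.single_smul, ← AddCircle.coe_nsmul, nsmul_eq_mul, mul_one_div_cancel hp',
      AddCircle.coe_period, Pi.single_zero]
  · have h : torusChar m (Pi.single i (((1 : ℝ) / p : ℝ) : AddCircle (1 : ℝ)))
        = fourier (m i) (((1 : ℝ) / p : ℝ) : AddCircle (1 : ℝ)) := by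
      rw [torusChar, Finset.prod_eq_single i]
      · simp
      · intro j _ hj
        simp [hj]
      · simp
    rw [h, fourier_coe_apply, Ne, Complex.exp_eq_one_iff]
    rintro ⟨n, hn⟩
    apply hm
    have hpc : (p : ℂ) ≠ 0 := by exact_mod_cast hp'
    refine ⟨n, ?_⟩
    have hpi := Complex.two_pi_I_ne_zero
    have h2 : (2 * Real.pi * Complex.I : ℂ) * m i = (2 * Real.pi * Complex.I) * (p * n) := by
      push_cast at hn
      field_simp at hn
      linear_combination (2 * Real.pi * Complex.I : ℂ) * hn
    exact_mod_cast mul_left_cancel₀ hpi h2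

lemma integral_mul_torusChar_eq_zero {d p : ℕ} (hp : 1 ≤ p) {G : Torus d → ℂ}
    (hG : TorsionInvariant p G) {m : Fin d → ℤ} {i : Fin d} (hm : ¬ (p : ℤ) ∣ m i) :
    ∫ y, G y * torusChar m y = 0 := by
  obtain ⟨t, ht, hne⟩ := exists_torsion_torusChar_ne_one hp hm
  have h := integral_add_right_eq_self (μ := volume) (fun y => G y * torusChar m y) t
  simp only [hG t ht, torusChar_add_right, ← mul_assoc, integral_mul_const] at h
  by_contra h0
  exact hne (mul_left_cancel₀ h0 (by rw [h, mul_one]))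

section Convolution

variable {d p : ℕ} {A B : Torus d → ℂ}

lemma TorsionInvariant.tconv (hA : TorsionInvariant p A) : TorsionInvariant p (tconv A B) := by
  intro t ht x
  simp only [_root_.tconv, add_sub_right_comm, hA t ht]

lemma Continuous.tconv (hA : Continuous A) (hB : Continuous B) : Continuous (tconv A B) := by
  have := continuous_parametric_integral_of_continuous (μ := (volume : Measure (Torus d)))
    (f := fun x y => A (x - y) * B y) (by fun_prop) isCompact_univ
  rwa [Measure.restrict_univ] at this

lemma tconv_mul_torusChar (hp : 1 ≤ p) (hA : TorsionInvariant p A) (hB : TorsionInvariant p B)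
    {k l : Fin d → ℤ} (hkl : (∀ i, (p : ℤ) ∣ l i - k i) → k = l) (x : Torus d) :
    ∫ y, (A (x - y) * torusChar k (x - y)) * (B y * torusChar l y) =
      if k = l then tconv A B x * torusChar k x else 0 := by
  have h : ∀ y, (A (x - y) * torusChar k (x - y)) * (B y * torusChar l y) =
      torusChar k x * ((A (x - y) * B y) * torusChar (l - k) y) := fun y => by
    linear_combination (A (x - y) * B y) * torusChar_sub_mul k l x y
  simp only [h, integral_const_mul]
  split_ifs with hk
  · subst hk
    simp [tconv, torusChar, mul_comm]
  · obtain ⟨i, hi⟩ := not_forall.mp fun h => hk (hkl h)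
    rw [integral_mul_torusChar_eq_zero hp (G := fun y => A (x - y) * B y) _ (i := i) hi, mul_zero]
    intro t ht y
    have := hA (-t) (by rw [smul_neg, ht, neg_zero]) (x - y)
    simp only [hB t ht, ← this]
    congr 2
    abel

lemma tconv_mul_sum_torusChar (hp : 1 ≤ p) (hAc : Continuous A) (hBc : Continuous B)
    (hA : TorsionInvariant p A) (hB : TorsionInvariant p B)
    {S T : Finset (Fin d → ℤ)} (b c : (Fin d → ℤ) → ℂ)
    (hST : ∀ k ∈ S, ∀ l ∈ T, (∀ i, (p : ℤ) ∣ l i - k i) → k = l) (x : Torus d) :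
    tconv (fun x => A x * ∑ k ∈ S, b k * torusChar k x)
        (fun x => B x * ∑ l ∈ T, c l * torusChar l x) x =
      tconv A B x * ∑ k ∈ S ∩ T, b k * c k * torusChar k x := by
  have hexp : ∀ y, (A (x - y) * ∑ k ∈ S, b k * torusChar k (x - y)) *
      (B y * ∑ l ∈ T, c l * torusChar l y) = ∑ k ∈ S, ∑ l ∈ T,
        b k * c l * ((A (x - y) * torusChar k (x - y)) * (B y * torusChar l y)) := fun y => by
    rw [mul_mul_mul_comm, Finset.sum_mul_sum, Finset.mul_sum]
    refine Finset.sum_congr rfl fun k _ => ?_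
    rw [Finset.mul_sum]
    exact Finset.sum_congr rfl fun l _ => by ring
  have hint : ∀ k l : Fin d → ℤ, Integrable fun y =>
      b k * c l * ((A (x - y) * torusChar k (x - y)) * (B y * torusChar l y)) := fun k l => by
    have := continuous_torusChar k
    have := continuous_torusChar l
    exact Continuous.integrable_of_hasCompactSupport (by fun_prop)
      (HasCompactSupport.of_compactSpace _)
  calc _ = ∑ k ∈ S, ∑ l ∈ T,
          b k * c l * if k = l then tconv A B x * torusChar k x else 0 := by
        simp only [tconv, hexp]
        rw [integral_finsetSum _ fun k _ => integrable_finsetSum _ fun l _ => hint k l]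
        refine Finset.sum_congr rfl fun k hk => ?_
        rw [integral_finsetSum _ fun l _ => hint k l]
        refine Finset.sum_congr rfl fun l hl => ?_
        rw [integral_const_mul, tconv_mul_torusChar hp hA hB (hST k hk l hl), tconv]
    _ = _ := by
        simp only [mul_ite, mul_zero, Finset.sum_ite_eq]
        rw [← Finset.sum_filter, Finset.filter_mem_eq_inter, Finset.mul_sum]
        exact Finset.sum_congr rfl fun k _ => by ring

lemma tconv_one_one : tconv (fun _ : Torus d => (1 : ℂ)) (fun _ => 1) = fun _ => 1 := by
  ext x
  simp [tconv, measureReal_def, volume_pi, Measure.pi_univ]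

end Convolution

section Periodization

variable {d p : ℕ} {f : Torus d → ℂ}

lemma TSmooth.continuous (hf : TSmooth f) : Continuous f :=
  (IsOpenQuotientMap.piMap fun _ : Fin d =>
    (QuotientAddGroup.isOpenQuotientMap_mk :
      IsOpenQuotientMap ((↑) : ℝ → AddCircle (1 : ℝ)))).isQuotientMap.continuous_iff.mpr
    (ContDiff.continuous hf)

lemma torsionInvariant_perz : TorsionInvariant p (perz p f) := by
  intro t ht x
  have : ∀ i, p • t i = 0 := fun i => congrFun ht i
  simp [perz, this]

lemma continuous_perz (hf : Continuous f) : Continuous (perz p f) := by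
  unfold perz
  fun_prop

end Periodization

/-- `P` is a trigonometric polynomial all of whose frequencies lie in `K`. -/
def IsTrigPoly {d : ℕ} (K : Set (Fin d → ℤ)) (P : Torus d → ℂ) : Prop :=
  ∃ (S : Finset (Fin d → ℤ)) (c : (Fin d → ℤ) → ℂ),
    (∀ k ∈ S, k ∈ K) ∧ P = fun x => ∑ k ∈ S, c k * torusChar k x

section Fold

variable {d p : ℕ} {K : Set (Fin d → ℤ)} {P Q : Torus d → ℂ}

lemma tconv_isTrigPoly (hp : 1 ≤ p)
    (hK : ∀ k ∈ K, ∀ l ∈ K, (∀ i, (p : ℤ) ∣ l i - k i) → k = l)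
    (hP : IsTrigPoly K P) (hQ : IsTrigPoly K Q) :
    IsTrigPoly K (tconv P Q) ∧ ∀ A B : Torus d → ℂ, Continuous A → Continuous B →
      TorsionInvariant p A → TorsionInvariant p B →
      tconv (fun x => A x * P x) (fun x => B x * Q x) = fun x => tconv A B x * tconv P Q x := by
  obtain ⟨S, b, hS, rfl⟩ := hP
  obtain ⟨T, c, hT, rfl⟩ := hQ
  have hST : ∀ k ∈ S, ∀ l ∈ T, (∀ i, (p : ℤ) ∣ l i - k i) → k = l :=
    fun k hk l hl => hK k (hS k hk) l (hT l hl)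
  have h1 : tconv (fun x => ∑ k ∈ S, b k * torusChar k x)
      (fun x => ∑ l ∈ T, c l * torusChar l x) =
      fun x => ∑ k ∈ S ∩ T, b k * c k * torusChar k x := by
    ext x
    simpa [tconv_one_one] using tconv_mul_sum_torusChar hp (A := fun _ => 1) (B := fun _ => 1)
      continuous_const continuous_const (fun _ _ _ => rfl) (fun _ _ _ => rfl) b c hST x
  rw [h1]
  refine ⟨⟨S ∩ T, fun k => b k * c k, fun k hk => hS k (Finset.mem_inter.mp hk).1, rfl⟩, ?_⟩
  intro A B hAc hBc hA hB
  exact funext (tconv_mul_sum_torusChar hp hAc hBc hA hB b c hST)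

lemma tconvFold_mul (hp : 1 ≤ p)
    (hK : ∀ k ∈ K, ∀ l ∈ K, (∀ i, (p : ℤ) ∣ l i - k i) → k = l) (n : ℕ)
    (G P : Fin (n + 1) → Torus d → ℂ) (hGc : ∀ ν, Continuous (G ν))
    (hG : ∀ ν, TorsionInvariant p (G ν)) (hP : ∀ ν, IsTrigPoly K (P ν)) :
    Continuous (tconvFold n G) ∧ TorsionInvariant p (tconvFold n G) ∧
      IsTrigPoly K (tconvFold n P) ∧
      tconvFold n (fun ν x => G ν x * P ν x) = fun x => tconvFold n G x * tconvFold n P x := by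
  induction n with
  | zero => exact ⟨hGc 0, hG 0, hP 0, rfl⟩
  | succ n ih =>
    obtain ⟨hc, hi, ht, he⟩ := ih (fun i => G i.succ) (fun i => P i.succ)
      (fun i => hGc i.succ) (fun i => hG i.succ) (fun i => hP i.succ)
    obtain ⟨ht', he'⟩ := tconv_isTrigPoly hp hK (hP 0) ht
    refine ⟨(hGc 0).tconv hc, (hG 0).tconv, ht', ?_⟩
    simp only [tconvFold, he]
    exact he' _ _ (hGc 0) hc (hG 0) hi

end Fold

/-- K"orner's periodization lemma: if `P_ν` are trigonometric polynomials with frequencies in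
`ℛ = [a₁,a₁+p) × ⋯ × [a_d,a_d+p)` and `G_ν = Per_p f_ν`, then
`(G₁P₁) * ⋯ * (G_nP_n) = (G₁ * ⋯ * G_n) · (P₁ * ⋯ * P_n)`. -/
theorem periodization_convolution (d p n : ℕ) (hp : 1 ≤ p) (a : Fin d → ℝ)
    (f P : Fin (n + 1) → Torus d → ℂ)
    (hf : ∀ ν, TSmooth (f ν))
    (hP : ∀ ν, ∃ (S : Finset (Fin d → ℤ)) (c : (Fin d → ℤ) → ℂ),
        (∀ k ∈ S, ∀ i, a i ≤ (k i : ℝ) ∧ (k i : ℝ) < a i + p) ∧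
        P ν = fun x => ∑ k ∈ S, c k * ∏ i, fourier (k i) (x i)) :
    tconvFold n (fun ν => fun x => perz p (f ν) x * P ν x) =
      fun x => tconvFold n (fun ν => perz p (f ν)) x * tconvFold n P x := by
  refine (tconvFold_mul hp (K := {k | ∀ i, a i ≤ (k i : ℝ) ∧ (k i : ℝ) < a i + p}) ?_ n _ P
    (fun ν => continuous_perz (hf ν).continuous) (fun ν => torsionInvariant_perz) hP).2.2.2
  intro k hk l hl h
  ext i
  have h1 : l i - k i < p := by
    have : (l i : ℝ) - k i < p := by linarith [(hk i).1, (hl i).2]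
    exact_mod_cast this
  have h2 : k i - l i < p := by
    have : (k i : ℝ) - l i < p := by linarith [(hl i).1, (hk i).2]
    exact_mod_cast this
  have := Int.eq_zero_of_abs_lt_dvd (h i) (abs_lt.mpr ⟨by linarith, h1⟩)
  linarith
end

section
/- Let 1 ≤ p ≤ q ≤ 2 and let N be an integer with N > d(1/q − 1/2). There is a constant C = C(d, p, q, N) such that the following holds. Let μ be a Borel probability measure on ℝ^d satisfying the restriction inequality (∫ |f̂|² dμ)^{1/2} ≤ A_p ‖f‖_{L^p(ℝ^d)} for all Schwartz f, with some finite A_p. Let 0 < r ≤ 1, let η ∈ C^∞(ℝ^d) be supported in {ξ : r/4 ≤ |ξ| ≤ r} and satisfy r^{|β|} ‖∂^β η‖_∞ ≤ 1 for all multi-indices β with |β| ≤ N, and set h = η * μ. Then for every Schwartz function f, ‖ℱ^{−1}[h f̂]‖_{L^q(ℝ^d)} ≤ C r^{d − d/q} A_p (ϖ(r))^{1/2} ‖f‖_{L^p(ℝ^d)}, where ϖ(r) = sup_{x∈ℝ^d} μ(B(x,r)). -/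
open MeasureTheory Filter
open scoped ENNReal FourierTransform

section Fourier

variable {V : Type*} [NormedAddCommGroup V] [InnerProductSpace ℝ V] [FiniteDimensional ℝ V]
  [MeasurableSpace V] [BorelSpace V]

theorem integral_fourierInv_mul_eq_flip {f g : V → ℂ} (hf : Integrable f) (hg : Integrable g) :
    ∫ x, 𝓕⁻ f x * g x = ∫ x, f x * 𝓕⁻ g x := by
  have h := VectorFourier.integral_fourierIntegral_smul_eq_flip (μ := (volume : Measure V))
    (ν := (volume : Measure V)) (L := -innerₗ V) Real.continuous_fourierChar
    (by exact (continuous_inner (𝕜 := ℝ) (E := V)).neg) hf hg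
  have h2 : (-innerₗ V).flip = -innerₗ V := by
    ext x y
    simp [real_inner_comm]
  rw [h2] at h
  exact h

theorem integral_fourier_mul_eq_flip {f g : V → ℂ} (hf : Integrable f) (hg : Integrable g) :
    ∫ x, 𝓕 f x * g x = ∫ x, f x * 𝓕 g x := by
  have h := VectorFourier.integral_fourierIntegral_smul_eq_flip (μ := (volume : Measure V))
    (ν := (volume : Measure V)) (L := innerₗ V) Real.continuous_fourierChar
    (by exact continuous_inner (𝕜 := ℝ) (E := V)) hf hg
  rw [flip_innerₗ] at h
  exact h

theorem continuous_fourierInv_of_integrable {f : V → ℂ} (hf : Integrable f) :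
    Continuous (𝓕⁻ f) := by
  have h : Continuous (𝓕 f) := VectorFourier.fourierIntegral_continuous
    Real.continuous_fourierChar (by exact continuous_inner (𝕜 := ℝ) (E := V)) hf
  have : 𝓕⁻ f = fun x => 𝓕 f (-x) := funext fun x => Real.fourierInv_eq_fourier_neg f x
  rw [this]
  exact h.comp continuous_neg

/-- Plancherel's theorem for functions in `L¹ ∩ L²`. -/
theorem eLpNorm_fourierInv_of_integrable {f : V → ℂ} (h1 : Integrable f) (h2 : MemLp f 2) :
    eLpNorm (𝓕⁻ f) 2 volume = eLpNorm f 2 volume := by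
  set F : Lp (α := V) ℂ 2 volume := 𝓕⁻ (h2.toLp f) with hF
  have key : ∀ᵐ x, F x = 𝓕⁻ f x := by
    refine ae_eq_of_integral_contDiff_smul_eq (μ := volume) ?_ ?_ ?_
    · exact (Lp.memLp F).locallyIntegrable one_le_two
    · exact (continuous_fourierInv_of_integrable h1).locallyIntegrable
    · intro g hg hgs
      have hg' : ContDiff ℝ (⊤ : ℕ∞) (fun x => (g x : ℂ)) := Complex.ofRealCLM.contDiff.comp hg
      have hgs' : HasCompactSupport (fun x => (g x : ℂ)) :=
        hgs.comp_left (g := ((↑) : ℝ → ℂ)) Complex.ofReal_zero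
      let φ : SchwartzMap V ℂ := hgs'.toSchwartzMap hg'
      have e1 := congrArg (fun T => T φ) (Lp.fourierInv_toTemperedDistribution_eq (h2.toLp f))
      simp only [TemperedDistribution.fourierInv_apply, Lp.toTemperedDistribution_apply] at e1
      rw [← hF] at e1
      have e2 := integral_fourierInv_mul_eq_flip h1 φ.integrable
      calc ∫ x, g x • F x = ∫ x, φ x • F x := by
            congr 1
        _ = ∫ x, (𝓕⁻ φ) x • (h2.toLp f) x := e1.symm
        _ = ∫ x, f x * 𝓕⁻ (φ : V → ℂ) x := by
            apply integral_congr_ae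
            filter_upwards [h2.coeFn_toLp] with x hx
            rw [hx, SchwartzMap.fourierInv_coe, smul_eq_mul, mul_comm]
        _ = ∫ x, g x • 𝓕⁻ f x := by
            rw [← e2]
            congr 1
            ext x
            rw [mul_comm]
            rfl
  have hn : ‖F‖ = ‖h2.toLp f‖ := (Lp.fourierTransformₗᵢ V ℂ).symm.norm_map _
  rw [← eLpNorm_congr_ae key]
  rw [Lp.norm_def, Lp.norm_def, ENNReal.toReal_eq_toReal_iff' (Lp.eLpNorm_ne_top _)
    (Lp.eLpNorm_ne_top _)] at hn
  rw [hn, eLpNorm_congr_ae h2.coeFn_toLp]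

theorem integrable_fourierChar_inner_smul {f : V → ℂ} (hf : Integrable f) (x : V) :
    Integrable (fun ξ => Real.fourierChar (inner ℝ ξ x) • f ξ) := by
  have h := (Real.fourierIntegral_convergent_iff (μ := volume) (f := f) (-x)).2 hf
  simpa using h

/-- Multiplication by a character preserves Schwartz functions and translates the Fourier
transform. -/
theorem exists_schwartzMap_modulation (u : SchwartzMap V ℂ) (ζ : V) :
    ∃ v : SchwartzMap V ℂ, (∀ y, v y = Real.fourierChar (-inner ℝ y ζ) • u y) ∧
      ∀ ξ, 𝓕 (v : V → ℂ) ξ = 𝓕 (u : V → ℂ) (ξ + ζ) := by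
  have hF (v : SchwartzMap V ℂ) (hv : ∀ y, v y = Real.fourierChar (-inner ℝ y ζ) • u y) (ξ : V) :
      𝓕 (v : V → ℂ) ξ = 𝓕 (u : V → ℂ) (ξ + ζ) := by
    rw [Real.fourier_eq, Real.fourier_eq]
    congr 1
    ext y
    rw [hv, inner_add_right, neg_add, AddChar.map_add_eq_mul, mul_smul]
  refine ⟨𝓕⁻ ((𝓕 u).compSubConstCLM ℂ (-ζ)), ?_⟩
  suffices h : ∀ y, (𝓕⁻ ((𝓕 u).compSubConstCLM ℂ (-ζ)) : SchwartzMap V ℂ) y =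
      Real.fourierChar (-inner ℝ y ζ) • u y from ⟨h, hF _ h⟩
  intro y
  have h1 : u y = 𝓕⁻ ((𝓕 u : SchwartzMap V ℂ) : V → ℂ) y := by
    rw [← SchwartzMap.fourierInv_coe, FourierTransform.fourierInv_fourier_eq]
  rw [SchwartzMap.fourierInv_coe, h1, Real.fourierInv_eq, Real.fourierInv_eq,
    ← integral_sub_right_eq_self _ ζ, Circle.smul_def, ← integral_smul]
  congr 1
  ext ξ
  simp only [SchwartzMap.compSubConstCLM_apply, sub_neg_eq_add, sub_add_cancel, inner_sub_left]
  rw [sub_eq_add_neg, AddChar.map_add_eq_mul, mul_comm, mul_smul, real_inner_comm y ζ]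
  simp only [Circle.smul_def]

/-- The inverse Fourier transform of a product with a Fourier transform is a convolution. -/
theorem fourierInv_mul_fourier_eq_integral {h f : V → ℂ} (hh : Integrable h) (hf : Integrable f)
    (x : V) : 𝓕⁻ (fun ξ => h ξ * 𝓕 f ξ) x = ∫ y, 𝓕⁻ h (x - y) * f y := by
  have e := integral_fourier_mul_eq_flip hf (integrable_fourierChar_inner_smul hh x)
  rw [Real.fourierInv_eq]
  calc _ = ∫ ξ, 𝓕 f ξ * (Real.fourierChar (inner ℝ ξ x) • h ξ) := by
        congr 1
        ext ξ
        simp only [Circle.smul_def, smul_eq_mul]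
        ring
    _ = _ := by
        rw [e]
        congr 1
        ext y
        rw [mul_comm, Real.fourierInv_eq, Real.fourier_eq]
        congr 2
        ext ξ
        rw [← mul_smul, ← AddChar.map_add_eq_mul, inner_sub_right, neg_add_eq_sub]

/-- The convolution of a function with a measure. -/
noncomputable def convMeasure (g : V → ℂ) (μ : Measure V) (ξ : V) : ℂ := ∫ w, g (ξ - w) ∂μ

theorem integrable_prod_comp_sub (μ : Measure V) [IsFiniteMeasure μ] {g : V → ℂ}
    (hg : Integrable g) : Integrable (fun p : V × V => g (p.1 - p.2)) (volume.prod μ) := by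
  simpa using! Integrable.convolution_integrand (ContinuousLinearMap.mul ℝ ℂ)
    (integrable_const (1 : ℂ) : Integrable (fun _ : V => (1 : ℂ)) μ) hg

theorem integrable_convMeasure (μ : Measure V) [IsFiniteMeasure μ] {g : V → ℂ}
    (hg : Integrable g) : Integrable (convMeasure g μ) :=
  (integrable_prod_comp_sub μ hg).integral_prod_left

/-- The inverse Fourier transform turns convolution with a measure into a product. -/
theorem fourierInv_convMeasure (μ : Measure V) [IsFiniteMeasure μ] {g : V → ℂ}
    (hg : Integrable g) (x : V) :
    𝓕⁻ (convMeasure g μ) x = (∫ w, (Real.fourierChar (inner ℝ w x) : ℂ) ∂μ) * 𝓕⁻ g x := by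
  rw [Real.fourierInv_eq, Real.fourierInv_eq]
  have hi : Integrable (fun p : V × V => Real.fourierChar (inner ℝ p.1 x) • g (p.1 - p.2))
      (volume.prod μ) := by
    refine (integrable_prod_comp_sub μ hg).mono ?_ (by simp)
    have h2 : Continuous fun p : V × V => (Real.fourierChar (inner ℝ p.1 x) : ℂ) := by fun_prop
    exact h2.aestronglyMeasurable.smul (integrable_prod_comp_sub μ hg).aestronglyMeasurable
  calc _ = ∫ ξ, ∫ w, Real.fourierChar (inner ℝ ξ x) • g (ξ - w) ∂μ := by
        congr 1
        ext ξ
        simp only [Circle.smul_def, convMeasure]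
        rw [integral_smul]
    _ = ∫ w, (∫ ξ, Real.fourierChar (inner ℝ ξ x) • g (ξ - w)) ∂μ := integral_integral_swap hi
    _ = ∫ w, (Real.fourierChar (inner ℝ w x) : ℂ) *
          (∫ v, Real.fourierChar (inner ℝ v x) • g v) ∂μ := by
        congr 1
        ext w
        rw [← integral_add_right_eq_self _ w, ← smul_eq_mul, ← integral_smul]
        congr 1
        ext v
        simp only [add_sub_cancel_right, inner_add_left, Circle.smul_def]
        rw [AddChar.map_add_eq_mul, mul_comm, Circle.coe_mul, mul_smul]
    _ = _ := integral_mul_const _ _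

theorem lintegral_enorm_sq_eq_eLpNorm_sq {α : Type*} [MeasurableSpace α] (μ : Measure α)
    (f : α → ℂ) : ∫⁻ x, ‖f x‖ₑ ^ 2 ∂μ = eLpNorm f 2 μ ^ 2 := by
  have h := eLpNorm_nnreal_pow_eq_lintegral (μ := μ) (f := f) (p := 2) two_ne_zero
  simpa using! h.symm

theorem enorm_convMeasure_le {E : Type*} [NormedAddCommGroup E] [MeasurableSpace E] [BorelSpace E]
    (μ : Measure E) {g : E → ℂ} {M : ℝ≥0∞} (hM : ∀ ξ, ‖g ξ‖ₑ ≤ M)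
    {r : ℝ} (hs : ∀ ξ, r < ‖ξ‖ → g ξ = 0) (ξ : E) :
    ‖convMeasure g μ ξ‖ₑ ≤ M * μ (Metric.closedBall ξ r) := by
  calc ‖convMeasure g μ ξ‖ₑ ≤ ∫⁻ w, ‖g (ξ - w)‖ₑ ∂μ := enorm_integral_le_lintegral_enorm _
    _ ≤ ∫⁻ w, (Metric.closedBall ξ r).indicator (fun _ => M) w ∂μ := by
        refine lintegral_mono fun w => ?_
        by_cases hw : w ∈ Metric.closedBall ξ r
        · simpa [hw] using hM _
        · have : r < ‖ξ - w‖ := by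
            rw [Metric.mem_closedBall, dist_comm, dist_eq_norm] at hw
            exact not_le.1 hw
          simp [hs _ this]
    _ = M * μ (Metric.closedBall ξ r) :=
        lintegral_indicator_const Metric.isClosed_closedBall.measurableSet _

/-- Averaging the restriction inequality over translations of the measure. -/
theorem lintegral_measure_closedBall_mul_le (μ : Measure V) [IsFiniteMeasure μ] {p R : ℝ≥0∞}
    (hR : ∀ u : SchwartzMap V ℂ,
      ∫⁻ ξ, ‖𝓕 (u : V → ℂ) ξ‖ₑ ^ 2 ∂μ ≤ (R * eLpNorm u p volume) ^ 2)
    (r : ℝ) (u : SchwartzMap V ℂ) :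
    ∫⁻ ξ, μ (Metric.closedBall ξ r) * ‖𝓕 (u : V → ℂ) ξ‖ₑ ^ 2 ≤
      volume (Metric.closedBall (0 : V) r) * (R * eLpNorm u p volume) ^ 2 := by
  have hc : Continuous (𝓕 (u : V → ℂ)) := by
    rw [← SchwartzMap.fourier_coe]
    exact (𝓕 u).continuous
  have hB : MeasurableSet (Metric.closedBall (0 : V) r) := Metric.isClosed_closedBall.measurableSet
  set k : V → ℝ≥0∞ := (Metric.closedBall (0 : V) r).indicator (fun _ => 1) with hk
  have hkm : Measurable k := measurable_const.indicator hB
  have hcm : Measurable fun ξ => ‖𝓕 (u : V → ℂ) ξ‖ₑ ^ 2 := (hc.measurable.enorm).pow_const 2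
  have hball (ξ : V) : μ (Metric.closedBall ξ r) = ∫⁻ w, k (ξ - w) ∂μ := by
    rw [← lintegral_indicator_one Metric.isClosed_closedBall.measurableSet]
    congr 1
    ext w
    simp only [hk, Set.indicator, Metric.mem_closedBall, dist_zero_right, dist_comm w ξ,
      dist_eq_norm ξ w]
    rfl
  calc ∫⁻ ξ, μ (Metric.closedBall ξ r) * ‖𝓕 (u : V → ℂ) ξ‖ₑ ^ 2
      = ∫⁻ ξ, ∫⁻ w, k (ξ - w) * ‖𝓕 (u : V → ℂ) ξ‖ₑ ^ 2 ∂μ := by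
        congr 1
        ext ξ
        rw [hball, lintegral_mul_const _ (by fun_prop)]
    _ = ∫⁻ w, (∫⁻ ξ, k (ξ - w) * ‖𝓕 (u : V → ℂ) ξ‖ₑ ^ 2) ∂μ := by
        refine lintegral_lintegral_swap (Measurable.aemeasurable ?_)
        exact (hkm.comp (measurable_fst.sub measurable_snd)).mul (hcm.comp measurable_fst)
    _ = ∫⁻ w, (∫⁻ v, k v * ‖𝓕 (u : V → ℂ) (v + w)‖ₑ ^ 2) ∂μ := by
        congr 1
        ext w
        rw [← lintegral_add_right_eq_self _ w]
        simp
    _ = ∫⁻ v, ∫⁻ w, k v * ‖𝓕 (u : V → ℂ) (v + w)‖ₑ ^ 2 ∂μ := by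
        refine lintegral_lintegral_swap (Measurable.aemeasurable ?_)
        exact (hkm.comp measurable_snd).mul (hcm.comp (measurable_snd.add measurable_fst))
    _ ≤ ∫⁻ v, k v * (R * eLpNorm u p volume) ^ 2 := by
        refine lintegral_mono fun v => ?_
        have hm : Measurable fun w => ‖𝓕 (u : V → ℂ) (v + w)‖ₑ ^ 2 :=
          hcm.comp (measurable_const_add v)
        rw [lintegral_const_mul _ hm]
        gcongr
        obtain ⟨u', h1, h2⟩ := exists_schwartzMap_modulation u v
        have e : eLpNorm u' p volume = eLpNorm u p volume :=
          eLpNorm_congr_norm_ae (ae_of_all _ fun y => by rw [h1, Circle.norm_smul])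
        rw [← e]
        simpa only [h2, add_comm] using hR u'
    _ = _ := by
        rw [lintegral_mul_const _ hkm, lintegral_indicator_const hB, one_mul]

/-- The `L^p → L²` bound for the multiplier `g * μ`, with `g` bounded and supported in a ball. -/
theorem lintegral_enorm_sq_convMeasure_multiplier_le (μ : Measure V) [IsFiniteMeasure μ]
    {p R : ℝ≥0∞}
    (hR : ∀ u : SchwartzMap V ℂ,
      ∫⁻ ξ, ‖𝓕 (u : V → ℂ) ξ‖ₑ ^ 2 ∂μ ≤ (R * eLpNorm u p volume) ^ 2)
    {g : V → ℂ} (hg : Integrable g) {M : ℝ≥0∞} (hMt : M ≠ ∞) (hM : ∀ ξ, ‖g ξ‖ₑ ≤ M)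
    {r : ℝ} (hs : ∀ ξ, r < ‖ξ‖ → g ξ = 0) (u : SchwartzMap V ℂ) :
    ∫⁻ x, ‖∫ y, 𝓕⁻ (convMeasure g μ) (x - y) * u y‖ₑ ^ 2 ≤
      (M * ((⨆ x, μ (Metric.closedBall x r)) * volume (Metric.closedBall (0 : V) r)) ^ (1 / 2 : ℝ)
        * R * eLpNorm u p volume) ^ 2 := by
  set W := ⨆ x, μ (Metric.closedBall x r)
  have hh := integrable_convMeasure μ hg
  have hb (ξ : V) : ‖convMeasure g μ ξ‖ ≤ (M * μ Set.univ).toReal := by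
    rw [← toReal_enorm]
    refine ENNReal.toReal_mono (ENNReal.mul_ne_top hMt (measure_ne_top _ _)) ?_
    exact (enorm_convMeasure_le μ hM hs ξ).trans (by gcongr; exact Set.subset_univ _)
  have hF : 𝓕 (u : V → ℂ) = ((𝓕 u : SchwartzMap V ℂ) : V → ℂ) := (SchwartzMap.fourier_coe u).symm
  have h1 : Integrable (fun ξ => convMeasure g μ ξ * 𝓕 (u : V → ℂ) ξ) := by
    rw [hF]
    exact (𝓕 u).integrable.bdd_mul hh.aestronglyMeasurable (ae_of_all _ hb)
  have h2 : MemLp (fun ξ => convMeasure g μ ξ * 𝓕 (u : V → ℂ) ξ) 2 := by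
    rw [hF]
    refine MemLp.of_le_mul (c := (M * μ Set.univ).toReal) ((𝓕 u).memLp 2 volume)
      (hF ▸ h1.aestronglyMeasurable) (ae_of_all _ fun ξ => ?_)
    rw [norm_mul]
    gcongr
    exact hb ξ
  calc ∫⁻ x, ‖∫ y, 𝓕⁻ (convMeasure g μ) (x - y) * u y‖ₑ ^ 2
      = ∫⁻ x, ‖𝓕⁻ (fun ξ => convMeasure g μ ξ * 𝓕 (u : V → ℂ) ξ) x‖ₑ ^ 2 := by
        simp only [fourierInv_mul_fourier_eq_integral hh u.integrable]
    _ = ∫⁻ ξ, ‖convMeasure g μ ξ * 𝓕 (u : V → ℂ) ξ‖ₑ ^ 2 := by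
        rw [lintegral_enorm_sq_eq_eLpNorm_sq, lintegral_enorm_sq_eq_eLpNorm_sq,
          eLpNorm_fourierInv_of_integrable h1 h2]
    _ ≤ ∫⁻ ξ, (M ^ 2 * W) * (μ (Metric.closedBall ξ r) * ‖𝓕 (u : V → ℂ) ξ‖ₑ ^ 2) := by
        refine lintegral_mono fun ξ => ?_
        rw [enorm_mul, mul_pow]
        calc _ ≤ (M * μ (Metric.closedBall ξ r)) ^ 2 * ‖𝓕 (u : V → ℂ) ξ‖ₑ ^ 2 := by
              gcongr
              exact enorm_convMeasure_le μ hM hs ξ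
          _ = M ^ 2 * μ (Metric.closedBall ξ r) *
              (μ (Metric.closedBall ξ r) * ‖𝓕 (u : V → ℂ) ξ‖ₑ ^ 2) := by ring
          _ ≤ _ := by
              gcongr
              exact le_iSup (fun x => μ (Metric.closedBall x r)) ξ
    _ = (M ^ 2 * W) * ∫⁻ ξ, (μ (Metric.closedBall ξ r) * ‖𝓕 (u : V → ℂ) ξ‖ₑ ^ 2) := by
        refine lintegral_const_mul' _ _ (ENNReal.mul_ne_top (by finiteness) ?_)
        exact ne_top_of_le_ne_top (measure_ne_top μ Set.univ)
          (iSup_le fun x => measure_mono (Set.subset_univ _))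
    _ ≤ (M ^ 2 * W) * (volume (Metric.closedBall (0 : V) r) * (R * eLpNorm u p volume) ^ 2) := by
        gcongr
        exact lintegral_measure_closedBall_mul_le μ hR r u
    _ = _ := by
        rw [mul_assoc (M * _), mul_pow (M * _), mul_pow M, ← ENNReal.rpow_two (_ ^ (1 / 2 : ℝ)),
          ← ENNReal.rpow_mul]
        norm_num
        ring

theorem ENNReal.lintegral_mul_sq_le {α : Type*} [MeasurableSpace α] (μ : Measure α)
    {w f : α → ℝ≥0∞} (hw : AEMeasurable w μ) (hf : AEMeasurable f μ) :
    (∫⁻ x, w x * f x ∂μ) ^ 2 ≤ (∫⁻ x, w x ∂μ) * ∫⁻ x, w x * f x ^ 2 ∂μ := by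
  have h := ENNReal.lintegral_mul_le_Lp_mul_Lq μ Real.HolderConjugate.two_two
    (hw.pow_const (1 / 2 : ℝ)) ((hw.pow_const (1 / 2 : ℝ)).mul hf)
  have hsq (a : ℝ≥0∞) : a ^ (1 / 2 : ℝ) * a ^ (1 / 2 : ℝ) = a := by
    rw [← ENNReal.rpow_add_of_nonneg _ _ (by norm_num) (by norm_num)]
    norm_num
  have hsq' (a : ℝ≥0∞) : (a ^ (1 / 2 : ℝ)) ^ 2 = a := by rw [sq, hsq]
  simp only [Pi.mul_apply, ← mul_assoc, hsq, ENNReal.rpow_two, mul_pow, hsq'] at h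
  calc _ ≤ ((∫⁻ x, w x ∂μ) ^ (1 / 2 : ℝ) * (∫⁻ x, w x * f x ^ 2 ∂μ) ^ (1 / 2 : ℝ)) ^ 2 := by
        gcongr
    _ = _ := by rw [mul_pow, hsq', hsq']

/-- Multiplying a convolution kernel by a dilated Schwartz function preserves `L^p → L²` bounds:
the Schwartz function is a superposition of characters. -/
theorem lintegral_enorm_sq_schwartzMap_mul_kernel_le {p B : ℝ≥0∞} {G : V → ℂ}
    (hG : Continuous G) {C : ℝ} (hC : ∀ x, ‖G x‖ ≤ C)
    (hB : ∀ u : SchwartzMap V ℂ,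
      ∫⁻ x, ‖∫ y, G (x - y) * u y‖ₑ ^ 2 ≤ (B * eLpNorm u p volume) ^ 2)
    (ψ : SchwartzMap V ℂ) (a : ℝ) (u : SchwartzMap V ℂ) :
    ∫⁻ x, ‖∫ y, ψ (a • (x - y)) * G (x - y) * u y‖ₑ ^ 2 ≤
      ((∫⁻ ζ, ‖𝓕 ψ ζ‖ₑ) * B * eLpNorm u p volume) ^ 2 := by
  set w : SchwartzMap V ℂ := 𝓕 ψ with hw
  have hchar : Continuous fun t : ℝ => (Real.fourierChar t : ℂ) := by fun_prop
  set F : V → V → ℂ := fun ζ x =>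
    ∫ y, G (x - y) * ((Real.fourierChar (-inner ℝ y (a • ζ)) : ℂ) * u y) with hF
  have hFm : StronglyMeasurable (fun q : V × V => F q.2 q.1) := by
    have : Continuous fun s : (V × V) × V =>
        G (s.1.1 - s.2) * ((Real.fourierChar (-inner ℝ s.2 (a • s.1.2)) : ℂ) * u s.2) := by
      have := u.continuous
      fun_prop
    exact this.stronglyMeasurable.integral_prod_right
  have hFB (ζ : V) : ∫⁻ x, ‖F ζ x‖ₑ ^ 2 ≤ (B * eLpNorm u p volume) ^ 2 := by
    obtain ⟨v, h1, -⟩ := exists_schwartzMap_modulation u (a • ζ)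
    have e : eLpNorm v p volume = eLpNorm u p volume :=
      eLpNorm_congr_norm_ae (ae_of_all _ fun y => by rw [h1, Circle.norm_smul])
    rw [← e]
    simpa only [h1, Circle.smul_def, smul_eq_mul] using hB v
  have hrep (x : V) : ∫ y, ψ (a • (x - y)) * G (x - y) * u y =
      ∫ ζ, (Real.fourierChar (inner ℝ ζ (a • x)) : ℂ) * (w ζ * F ζ x) := by
    have hψ (z : V) : ψ z = ∫ ζ, (Real.fourierChar (inner ℝ ζ z) : ℂ) * w ζ := by
      have : ψ = 𝓕⁻ w := by rw [hw, FourierTransform.fourierInv_fourier_eq]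
      rw [this, SchwartzMap.fourierInv_coe, Real.fourierInv_eq]
      rfl
    have hi : Integrable (fun q : V × V => (Real.fourierChar (inner ℝ q.2 (a • (x - q.1))) : ℂ)
        * G (x - q.1) * (u q.1 * w q.2)) (volume.prod volume) := by
      refine (u.integrable.mul_prod w.integrable).bdd_mul (c := C) ?_ (ae_of_all _ fun q => ?_)
      · refine Continuous.aestronglyMeasurable ?_
        fun_prop
      · rw [norm_mul, Circle.norm_coe, one_mul]
        exact hC _
    calc _ = ∫ y, ∫ ζ, (Real.fourierChar (inner ℝ ζ (a • (x - y))) : ℂ)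
        * G (x - y) * (u y * w ζ) := by
          congr 1
          ext y
          rw [hψ, mul_assoc, ← integral_mul_const]
          congr 1
          ext ζ
          ring
      _ = ∫ ζ, ∫ y, (Real.fourierChar (inner ℝ ζ (a • (x - y))) : ℂ)
        * G (x - y) * (u y * w ζ) := integral_integral_swap hi
      _ = _ := by
          congr 1
          ext ζ
          rw [← mul_assoc, hF, ← integral_const_mul]
          congr 1
          ext y
          have : inner ℝ ζ (a • (x - y)) = inner ℝ ζ (a • x) + -inner ℝ y (a • ζ) := by
            rw [smul_sub, inner_sub_right, sub_eq_add_neg, inner_smul_right, inner_smul_right,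
              inner_smul_right, real_inner_comm ζ y]
          rw [this, AddChar.map_add_eq_mul, Circle.coe_mul]
          ring
  have hwm : Measurable fun ζ => ‖w ζ‖ₑ := w.continuous.measurable.enorm
  calc _ ≤ ∫⁻ x, (∫⁻ ζ, ‖w ζ‖ₑ * ‖F ζ x‖ₑ) ^ 2 := by
        refine lintegral_mono fun x => ?_
        rw [hrep]
        refine pow_le_pow_left' ((enorm_integral_le_lintegral_enorm _).trans_eq ?_) 2
        congr 1
        ext ζ
        rw [enorm_mul, enorm_mul, ← ofReal_norm (Real.fourierChar _ : ℂ), Circle.norm_coe]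
        simp
    _ ≤ ∫⁻ x, (∫⁻ ζ, ‖w ζ‖ₑ) * ∫⁻ ζ, ‖w ζ‖ₑ * ‖F ζ x‖ₑ ^ 2 := by
        refine lintegral_mono fun x => ENNReal.lintegral_mul_sq_le _ hwm.aemeasurable ?_
        exact ((hFm.measurable.comp measurable_prodMk_left).enorm).aemeasurable
    _ = (∫⁻ ζ, ‖w ζ‖ₑ) * ∫⁻ x, ∫⁻ ζ, ‖w ζ‖ₑ * ‖F ζ x‖ₑ ^ 2 :=
        lintegral_const_mul' _ _ w.integrable.2.ne
    _ = (∫⁻ ζ, ‖w ζ‖ₑ) * ∫⁻ ζ, ∫⁻ x, ‖w ζ‖ₑ * ‖F ζ x‖ₑ ^ 2 := by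
        congr 1
        refine lintegral_lintegral_swap (Measurable.aemeasurable ?_)
        exact (hwm.comp measurable_snd).mul ((hFm.measurable.enorm).pow_const 2)
    _ ≤ (∫⁻ ζ, ‖w ζ‖ₑ) * ∫⁻ ζ, ‖w ζ‖ₑ * (B * eLpNorm u p volume) ^ 2 := by
        gcongr with ζ
        rw [lintegral_const_mul' _ _ enorm_ne_top]
        gcongr
        exact hFB ζ
    _ = _ := by
        rw [lintegral_mul_const _ hwm]
        ring

theorem eLpNorm_ofReal_rpow_eq_lintegral {α : Type*} [MeasurableSpace α] (μ : Measure α)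
    (f : α → ℂ) {q : ℝ} (hq : 0 < q) :
    eLpNorm f (ENNReal.ofReal q) μ ^ q = ∫⁻ x, ‖f x‖ₑ ^ q ∂μ := by
  have h := eLpNorm_nnreal_pow_eq_lintegral (μ := μ) (f := f) (p := q.toNNReal)
    (by simpa using hq)
  rwa [Real.coe_toNNReal q hq.le] at h

theorem measurable_setLIntegral_ball {g : V → ℝ≥0∞} (hg : Measurable g) (s : ℝ) :
    Measurable fun c => ∫⁻ x in Metric.ball c s, g x := by
  have h (c : V) : ∫⁻ x in Metric.ball c s, g x =
      ∫⁻ x, {q : V × V | dist q.2 q.1 < s}.indicator (fun q => g q.2) (c, x) := by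
    rw [← lintegral_indicator Metric.isOpen_ball.measurableSet]
    rfl
  simp only [h]
  refine Measurable.lintegral_prod_right' ((hg.comp measurable_snd).indicator ?_)
  exact (isOpen_lt (by fun_prop) continuous_const).measurableSet

theorem lintegral_setLIntegral_ball {g : V → ℝ≥0∞} (hg : Measurable g) (s : ℝ) :
    ∫⁻ c, ∫⁻ x in Metric.ball c s, g x = volume (Metric.ball (0 : V) s) * ∫⁻ x, g x := by
  set k : V → ℝ≥0∞ := (Metric.ball (0 : V) s).indicator (fun _ => 1) with hk
  have hkm : Measurable k := measurable_const.indicator Metric.isOpen_ball.measurableSet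
  have h (c : V) : ∫⁻ x in Metric.ball c s, g x = ∫⁻ x, k (x - c) * g x := by
    rw [← lintegral_indicator Metric.isOpen_ball.measurableSet]
    congr 1
    ext x
    simp [hk, Set.indicator, dist_eq_norm]
  calc _ = ∫⁻ x, ∫⁻ c, k (x - c) * g x := by
        simp only [h]
        refine lintegral_lintegral_swap (Measurable.aemeasurable ?_)
        exact (hkm.comp (measurable_snd.sub measurable_fst)).mul (hg.comp measurable_snd)
    _ = ∫⁻ x, volume (Metric.ball (0 : V) s) * g x := by
        congr 1
        ext x
        have hm : Measurable fun c => k (x - c) := hkm.comp (measurable_const_sub x)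
        rw [lintegral_mul_const _ hm,
          lintegral_sub_left_eq_self k x, hk,
          lintegral_indicator_const Metric.isOpen_ball.measurableSet, one_mul]
    _ = _ := lintegral_const_mul _ hg

theorem stronglyMeasurable_integral_kernel_mul {k : V → ℂ} (hk : Continuous k)
    (f : SchwartzMap V ℂ) : StronglyMeasurable fun x => ∫ y, k (x - y) * f y := by
  have : Continuous fun s : V × V => k (s.1 - s.2) * f s.2 := by
    have := f.continuous
    fun_prop
  exact this.stronglyMeasurable.integral_prod_right

/-- An `L^p → L²` bound for a kernel supported in a ball localizes to an `L^p → L^q` bound. -/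
theorem eLpNorm_kernel_le_of_support_subset_closedBall {p q : ℝ} (hp : 1 ≤ p) (hpq : p ≤ q)
    (hq : q ≤ 2) {k : V → ℂ} (hk : Continuous k) {ρ : ℝ} (hρ : 0 < ρ)
    (hs : ∀ z, 2 * ρ < ‖z‖ → k z = 0) {B : ℝ≥0∞}
    (hB : ∀ u : SchwartzMap V ℂ, ∫⁻ x, ‖∫ y, k (x - y) * u y‖ₑ ^ 2 ≤
      (B * eLpNorm u (ENNReal.ofReal p) volume) ^ 2) (f : SchwartzMap V ℂ) :
    eLpNorm (fun x => ∫ y, k (x - y) * f y) (ENNReal.ofReal q) volume ≤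
      4 ^ Module.finrank ℝ V * volume (Metric.ball (0 : V) ρ) ^ (1 / q - 1 / 2) * B *
        eLpNorm f (ENNReal.ofReal p) volume := by
  have hp0 : 0 < p := by linarith
  have hq0 : 0 < q := by linarith
  set F : V → ℂ := fun x => ∫ y, k (x - y) * f y with hF
  have hFm : StronglyMeasurable F := stronglyMeasurable_integral_kernel_mul hk f
  set v := volume (Metric.ball (0 : V) ρ) with hv
  have hv0 : v ≠ 0 := (Metric.measure_ball_pos volume 0 hρ).ne'
  have hvt : v ≠ ∞ := measure_ball_lt_top.ne
  have hvc (c : V) : volume (Metric.ball c ρ) = v := Measure.addHaar_ball_center _ _ _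
  set N := eLpNorm f (ENNReal.ofReal p) volume with hN
  have hNp : N ^ p = ∫⁻ x, ‖f x‖ₑ ^ p := eLpNorm_ofReal_rpow_eq_lintegral _ _ hp0
  have hfm : Measurable fun x => ‖f x‖ₑ ^ p := (f.continuous.measurable.enorm).pow_const p
  set Y : V → ℝ≥0∞ := fun c => ∫⁻ x in Metric.ball c (4 * ρ), ‖f x‖ₑ ^ p with hY
  have hYN (c : V) : Y c ≤ N ^ p := by
    rw [hNp]
    exact setLIntegral_le_lintegral _ _
  have hlocal (c : V) : ∫⁻ x in Metric.ball c ρ, ‖F x‖ₑ ^ 2 ≤ (B * Y c ^ (1 / p)) ^ 2 := by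
    let χ : ContDiffBump c := ⟨3 * ρ, 4 * ρ, by linarith, by linarith⟩
    have hχ : Function.HasTemperateGrowth (fun y => (χ y : ℂ)) := by
      refine HasCompactSupport.hasTemperateGrowth
        (χ.hasCompactSupport.comp_left (g := ((↑) : ℝ → ℂ)) Complex.ofReal_zero) ?_
      exact Complex.ofRealCLM.contDiff.comp χ.contDiff
    set u : SchwartzMap V ℂ := SchwartzMap.smulLeftCLM ℂ (fun y => (χ y : ℂ)) f with hu
    have hux (y : V) : u y = (χ y : ℂ) * f y := by
      rw [hu, SchwartzMap.smulLeftCLM_apply_apply hχ, smul_eq_mul]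
    have huY : eLpNorm u (ENNReal.ofReal p) volume ≤ Y c ^ (1 / p) := by
      rw [one_div, ENNReal.le_rpow_inv_iff hp0, eLpNorm_ofReal_rpow_eq_lintegral _ _ hp0, hY]
      simp only
      rw [← lintegral_indicator Metric.isOpen_ball.measurableSet]
      refine lintegral_mono fun y => ?_
      by_cases hy : y ∈ Metric.ball c (4 * ρ)
      · rw [Set.indicator_of_mem hy, hux, enorm_mul]
        gcongr
        refine mul_le_of_le_one_left' ?_
        rw [← ofReal_norm, Complex.norm_real, Real.norm_of_nonneg χ.nonneg]
        exact ENNReal.ofReal_le_one.2 χ.le_one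
      · rw [hux, χ.zero_of_le_dist (by simpa using hy)]
        simp [hp0]
    calc _ = ∫⁻ x in Metric.ball c ρ, ‖∫ y, k (x - y) * u y‖ₑ ^ 2 := by
          refine setLIntegral_congr_fun Metric.isOpen_ball.measurableSet fun x hx => ?_
          simp only [hF]
          congr 3
          ext y
          by_cases hy : 2 * ρ < ‖x - y‖
          · rw [hs _ hy, zero_mul, zero_mul]
          · rw [hux, χ.one_of_mem_closedBall, Complex.ofReal_one, one_mul]
            rw [Metric.mem_closedBall]
            rw [Metric.mem_ball] at hx
            have := dist_triangle y x c
            rw [dist_comm y x, dist_eq_norm x y] at this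
            change dist y c ≤ 3 * ρ
            linarith
      _ ≤ ∫⁻ x, ‖∫ y, k (x - y) * u y‖ₑ ^ 2 := setLIntegral_le_lintegral _ _
      _ ≤ _ := (hB u).trans (by gcongr)
  have hX (c : V) : ∫⁻ x in Metric.ball c ρ, ‖F x‖ₑ ^ q ≤
      (v ^ (1 / q - 1 / 2) * B) ^ q * (N ^ p) ^ (q / p - 1) * Y c := by
    have h1 := eLpNorm_le_eLpNorm_mul_rpow_measure_univ (μ := volume.restrict (Metric.ball c ρ))
      (p := ENNReal.ofReal q) (q := 2) (f := F) (by simpa using hq)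
      hFm.aestronglyMeasurable.restrict
    rw [Measure.restrict_apply_univ, hvc, ENNReal.toReal_ofReal hq0.le, ENNReal.toReal_ofNat] at h1
    have h2 : eLpNorm F 2 (volume.restrict (Metric.ball c ρ)) ≤ B * Y c ^ (1 / p) := by
      have := hlocal c
      rw [lintegral_enorm_sq_eq_eLpNorm_sq] at this
      exact (ENNReal.pow_le_pow_left_iff two_ne_zero).1 this
    rw [← eLpNorm_ofReal_rpow_eq_lintegral _ _ hq0]
    calc _ ≤ (B * Y c ^ (1 / p) * v ^ (1 / q - 1 / 2)) ^ q := by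
          gcongr
          exact h1.trans (by gcongr)
      _ = (v ^ (1 / q - 1 / 2) * B) ^ q * Y c ^ ((q / p - 1) + 1) := by
          rw [mul_right_comm, mul_comm B, ENNReal.mul_rpow_of_nonneg _ _ hq0.le, ← ENNReal.rpow_mul]
          congr 2
          ring
      _ = (v ^ (1 / q - 1 / 2) * B) ^ q * (Y c ^ (q / p - 1) * Y c) := by
          rw [ENNReal.rpow_add_of_nonneg _ _ (sub_nonneg.2 ((one_le_div hp0).2 hpq)) zero_le_one,
            ENNReal.rpow_one]
      _ ≤ _ := by
          rw [mul_assoc]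
          gcongr
          · exact sub_nonneg.2 ((one_le_div hp0).2 hpq)
          · exact hYN c
  set P := (v ^ (1 / q - 1 / 2) * B) ^ q * (N ^ p) ^ (q / p - 1) with hP
  have hball : v * ∫⁻ x, ‖F x‖ₑ ^ q ≤ v * (4 ^ Module.finrank ℝ V * (P * N ^ p)) := by
    rw [← lintegral_setLIntegral_ball (hFm.measurable.enorm.pow_const q) ρ]
    calc _ ≤ ∫⁻ c, P * Y c := lintegral_mono hX
      _ = P * (volume (Metric.ball (0 : V) (4 * ρ)) * ∫⁻ x, ‖f x‖ₑ ^ p) := by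
          rw [lintegral_const_mul _ (measurable_setLIntegral_ball hfm _),
            lintegral_setLIntegral_ball hfm]
      _ = _ := by
          rw [Measure.addHaar_ball_mul_of_pos _ _ (by norm_num : (0 : ℝ) < 4), ← hNp,
            ENNReal.ofReal_pow (by norm_num), ENNReal.ofReal_ofNat]
          ring
  rw [ENNReal.mul_le_mul_iff_right hv0 hvt, ← eLpNorm_ofReal_rpow_eq_lintegral _ _ hq0] at hball
  have hfin : 4 ^ Module.finrank ℝ V * (P * N ^ p) ≤
      (4 ^ Module.finrank ℝ V * v ^ (1 / q - 1 / 2) * B * N) ^ q := by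
    have e1 : (N ^ p) ^ (q / p - 1) * N ^ p = N ^ q := by
      rw [← ENNReal.rpow_mul, ← ENNReal.rpow_add_of_nonneg _ _ _ hp0.le]
      · congr 1
        field_simp
        ring
      · exact mul_nonneg hp0.le (sub_nonneg.2 ((one_le_div hp0).2 hpq))
    rw [hP, mul_assoc, e1, ← ENNReal.mul_rpow_of_nonneg _ _ hq0.le, mul_assoc _ (v ^ _),
      mul_assoc (4 ^ _), ENNReal.mul_rpow_of_nonneg (4 ^ _) _ hq0.le]
    gcongr
    exact ENNReal.le_rpow_self_of_one_le (one_le_pow₀ (by norm_num)) (hp.trans hpq)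
  exact (ENNReal.rpow_le_rpow_iff hq0).1 (hball.trans hfin)

/-- Multiplication by a power of a linear form on the Fourier side of a smooth compactly supported
function is realized by an iterated derivative. -/
theorem exists_fourierInv_eq_inner_pow_mul {η : V → ℂ} (hη : ContDiff ℝ (⊤ : ℕ∞) η)
    (hc : HasCompactSupport η) (N : ℕ) {e : V} (he : ‖e‖ ≤ 1) (a : ℝ) :
    ∃ g : V → ℂ, Integrable g ∧ (∀ ξ, ‖g ξ‖ ≤ |a| * ‖iteratedFDeriv ℝ N η ξ‖) ∧
      ∀ x, 𝓕⁻ g x = a * (inner ℝ x e : ℂ) ^ N * 𝓕⁻ η x := by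
  have hD (n : ℕ) : Integrable (iteratedFDeriv ℝ n η) :=
    (hη.continuous_iteratedFDeriv (mod_cast le_top)).integrable_of_hasCompactSupport
      (hc.iteratedFDeriv n)
  set c : ℂ := (-(2 * Real.pi * Complex.I)) ^ N with hcdef
  have hc1 : 1 ≤ ‖c‖ := by
    rw [hcdef, norm_pow]
    refine one_le_pow₀ ?_
    simp only [norm_neg, norm_mul, Complex.norm_ofNat, Complex.norm_real, Complex.norm_I, mul_one,
      Real.norm_of_nonneg Real.pi_pos.le]
    linarith [Real.pi_gt_three]
  have hc0 : c ≠ 0 := norm_pos_iff.1 (by linarith)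
  refine ⟨fun ξ => a / c * iteratedFDeriv ℝ N η ξ fun _ => e, ?_, fun ξ => ?_, fun x => ?_⟩
  · refine Integrable.const_mul ?_ _
    exact ((ContinuousMultilinearMap.apply ℝ (fun _ : Fin N => V) ℂ
      (fun _ => e)).integrable_comp (hD N))
  · rw [norm_mul, norm_div, Complex.norm_real, Real.norm_eq_abs]
    gcongr
    · exact div_le_self (abs_nonneg a) hc1
    · refine (ContinuousMultilinearMap.le_opNorm _ _).trans ?_
      refine mul_le_of_le_one_right (norm_nonneg _) ?_
      exact Finset.prod_le_one (fun _ _ => norm_nonneg _) fun _ _ => he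
  · have h1 : 𝓕 (fun ξ => iteratedFDeriv ℝ N η ξ fun _ => e) (-x) =
        c * ((inner ℝ x e : ℂ) ^ N * 𝓕 η (-x)) := by
      rw [← Real.fourier_continuousMultilinearMap_apply (hD N),
        Real.fourier_iteratedFDeriv hη (fun n _ => hD n) (mod_cast le_top)]
      simp [hcdef, VectorFourier.fourierPowSMulRight_apply, innerSL_apply_apply ℝ]
    have h2 : 𝓕⁻ (fun ξ => a / c * iteratedFDeriv ℝ N η ξ fun _ => e) x =
        a / c * 𝓕⁻ (fun ξ => iteratedFDeriv ℝ N η ξ fun _ => e) x := by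
      simp only [Real.fourierInv_eq]
      rw [← integral_const_mul]
      congr 1
      ext v
      simp only [Circle.smul_def, smul_eq_mul]
      ring
    rw [h2, Real.fourierInv_eq_fourier_neg, h1, Real.fourierInv_eq_fourier_neg]
    field_simp

/-- A smooth cutoff at unit scale whose dyadic increments are divisible by `N`-th powers of
coordinates. -/
theorem exists_schwartzMap_cutoff (d N : ℕ) :
    ∃ (χ : SchwartzMap (EuclideanSpace ℝ (Fin d)) ℂ)
      (ψ : Fin d → SchwartzMap (EuclideanSpace ℝ (Fin d)) ℂ),
      (∀ x, ‖x‖ ≤ 1 → χ x = 1) ∧ (∀ x, ‖χ x‖ ≤ 1) ∧ (∀ x, 2 < ‖x‖ → χ x = 0) ∧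
      (∀ j x, 2 < ‖x‖ → ψ j x = 0) ∧
      ∀ x, χ x - χ ((2 : ℝ) • x) = ∑ j, ψ j x * (x j : ℂ) ^ N := by
  let b : ContDiffBump (0 : EuclideanSpace ℝ (Fin d)) := ⟨1, 2, by norm_num, by norm_num⟩
  have hb0 {x : EuclideanSpace ℝ (Fin d)} (hx : 2 ≤ ‖x‖) : b x = 0 :=
    b.zero_of_le_dist (by simpa using hx)
  have hb1 {x : EuclideanSpace ℝ (Fin d)} (hx : ‖x‖ ≤ 1) : b x = 1 :=
    b.one_of_mem_closedBall (by simpa using hx)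
  set φ : EuclideanSpace ℝ (Fin d) → ℝ := fun x => b x - b ((2 : ℝ) • x) with hφ
  have hφs : ContDiff ℝ (⊤ : ℕ∞) φ := by
    have := b.contDiff (n := (⊤ : ℕ∞))
    exact this.sub (this.comp (contDiff_const_smul (2 : ℝ)))
  have hφ0 {x : EuclideanSpace ℝ (Fin d)} (hx : 2 < ‖x‖) : φ x = 0 := by
    rw [hφ]
    simp only
    rw [hb0 hx.le, hb0 (by rw [norm_smul, Real.norm_ofNat]; linarith), sub_zero]
  set S : EuclideanSpace ℝ (Fin d) → ℝ := fun x => ∑ k, (x k) ^ (2 * N) with hS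
  have hS0 {x : EuclideanSpace ℝ (Fin d)} (hx : x ≠ 0) : S x ≠ 0 := by
    obtain ⟨k, hk⟩ : ∃ k, x k ≠ 0 := by
      by_contra! h
      exact hx (by ext k; simpa using h k)
    refine (Finset.sum_pos' (fun k _ => (even_two_mul N).pow_nonneg _)
      ⟨k, Finset.mem_univ k, ?_⟩).ne'
    exact (even_two_mul N).pow_pos hk
  have hcoord (j : Fin d) : ContDiff ℝ (⊤ : ℕ∞) fun x : EuclideanSpace ℝ (Fin d) => x j :=
    (EuclideanSpace.proj j : EuclideanSpace ℝ (Fin d) →L[ℝ] ℝ).contDiff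
  have hφn : φ =ᶠ[nhds 0] 0 := by
    filter_upwards [Metric.ball_mem_nhds (0 : EuclideanSpace ℝ (Fin d)) one_half_pos] with x hx
    rw [mem_ball_zero_iff] at hx
    simp only [hφ, Pi.zero_apply]
    rw [hb1 (by linarith), hb1 (by rw [norm_smul, Real.norm_ofNat]; linarith), sub_self]
  have hψs (j : Fin d) : ContDiff ℝ (⊤ : ℕ∞) fun x => φ x * (x j) ^ N / S x := by
    rw [contDiff_iff_contDiffAt]
    intro x
    by_cases hx : x = 0
    · subst hx
      refine (contDiffAt_const (c := (0 : ℝ))).congr_of_eventuallyEq ?_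
      filter_upwards [hφn] with x hx
      simp [hx]
    · refine ContDiffAt.div ?_ ?_ (hS0 hx)
      · exact (hφs.mul ((hcoord j).pow N)).contDiffAt
      · exact (ContDiff.sum fun k _ => (hcoord k).pow (2 * N)).contDiffAt
  have hψc (j : Fin d) : HasCompactSupport fun x => ((φ x * (x j) ^ N / S x : ℝ) : ℂ) := by
    refine HasCompactSupport.intro (isCompact_closedBall 0 2) fun x hx => ?_
    rw [hφ0 (by simpa using hx)]
    simp
  have hχc : HasCompactSupport fun x => (b x : ℂ) :=
    b.hasCompactSupport.comp_left (g := ((↑) : ℝ → ℂ)) Complex.ofReal_zero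
  refine ⟨hχc.toSchwartzMap (Complex.ofRealCLM.contDiff.comp b.contDiff),
    fun j => (hψc j).toSchwartzMap (Complex.ofRealCLM.contDiff.comp (hψs j)), fun x hx => ?_,
    fun x => ?_, fun x hx => ?_, fun j x hx => ?_, fun x => ?_⟩
  · change ((b x : ℝ) : ℂ) = 1
    rw [hb1 hx, Complex.ofReal_one]
  · change ‖((b x : ℝ) : ℂ)‖ ≤ 1
    rw [Complex.norm_real, Real.norm_of_nonneg b.nonneg]
    exact b.le_one
  · change ((b x : ℝ) : ℂ) = 0
    rw [hb0 hx.le, Complex.ofReal_zero]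
  · change ((φ x * (x j) ^ N / S x : ℝ) : ℂ) = 0
    rw [hφ0 hx, zero_mul, zero_div, Complex.ofReal_zero]
  · change ((b x : ℝ) : ℂ) - ((b ((2 : ℝ) • x) : ℝ) : ℂ) =
      ∑ j, ((φ x * (x j) ^ N / S x : ℝ) : ℂ) * ((x j : ℝ) : ℂ) ^ N
    simp only [← Complex.ofReal_sub, ← Complex.ofReal_pow, ← Complex.ofReal_mul,
      ← Complex.ofReal_sum]
    congr 1
    change φ x = _
    by_cases hx : x = 0
    · have := hφn.self_of_nhds
      subst hx
      simp only [Pi.zero_apply] at this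
      simp [this]
    · have (j : Fin d) : φ x * (x j) ^ N / S x * (x j) ^ N = φ x / S x * (x j) ^ (2 * N) := by
        ring
      simp only [this]
      rw [← Finset.mul_sum]
      exact (div_mul_cancel₀ _ (hS0 hx)).symm

theorem norm_fourierInv_le_integral_norm (h : V → ℂ) (x : V) : ‖𝓕⁻ h x‖ ≤ ∫ ξ, ‖h ξ‖ := by
  rw [Real.fourierInv_eq]
  refine (norm_integral_le_integral_norm _).trans_eq ?_
  simp only [Circle.norm_smul]

/-- The `L^p → L^q` bound for a spatially localized piece of the multiplier `g * μ`. -/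
theorem eLpNorm_schwartzMap_mul_convMeasure_multiplier_le {p q : ℝ} (hp : 1 ≤ p) (hpq : p ≤ q)
    (hq : q ≤ 2) (μ : Measure V) [IsFiniteMeasure μ] {R : ℝ≥0∞}
    (hR : ∀ u : SchwartzMap V ℂ,
      ∫⁻ ξ, ‖𝓕 (u : V → ℂ) ξ‖ₑ ^ 2 ∂μ ≤ (R * eLpNorm u (ENNReal.ofReal p) volume) ^ 2)
    {g : V → ℂ} (hg : Integrable g) {M : ℝ≥0∞} (hMt : M ≠ ∞) (hM : ∀ ξ, ‖g ξ‖ₑ ≤ M)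
    {r : ℝ} (hs : ∀ ξ, r < ‖ξ‖ → g ξ = 0) (ψ : SchwartzMap V ℂ) (hψ : ∀ x, 2 < ‖x‖ → ψ x = 0)
    {ρ : ℝ} (hρ : 0 < ρ) (f : SchwartzMap V ℂ) :
    eLpNorm (fun x => ∫ y, ψ (ρ⁻¹ • (x - y)) * 𝓕⁻ (convMeasure g μ) (x - y) * f y)
        (ENNReal.ofReal q) volume ≤
      4 ^ Module.finrank ℝ V * volume (Metric.ball (0 : V) ρ) ^ (1 / q - 1 / 2) *
        ((∫⁻ ζ, ‖𝓕 ψ ζ‖ₑ) *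
          (M * ((⨆ x, μ (Metric.closedBall x r)) *
            volume (Metric.closedBall (0 : V) r)) ^ (1 / 2 : ℝ) * R)) *
        eLpNorm f (ENNReal.ofReal p) volume := by
  have hK := continuous_fourierInv_of_integrable (integrable_convMeasure μ hg)
  have hk : Continuous fun z => ψ (ρ⁻¹ • z) * 𝓕⁻ (convMeasure g μ) z :=
    (ψ.continuous.comp (continuous_const_smul _)).mul hK
  refine eLpNorm_kernel_le_of_support_subset_closedBall hp hpq hq hk hρ (fun z hz => ?_) ?_ f
  · rw [hψ, zero_mul]
    rw [norm_smul, norm_inv, Real.norm_of_nonneg hρ.le, inv_mul_eq_div, lt_div_iff₀ hρ]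
    exact hz
  · exact lintegral_enorm_sq_schwartzMap_mul_kernel_le hK
      (norm_fourierInv_le_integral_norm _)
      (lintegral_enorm_sq_convMeasure_multiplier_le μ hR hg hMt hM hs) ψ ρ⁻¹

theorem volume_ball_two_pow_div_rpow {r : ℝ} (hr : 0 < r) {s : ℝ} (hs : 0 ≤ s) (m : ℕ) :
    volume (Metric.ball (0 : V) (2 ^ m / r)) ^ s =
      volume (Metric.ball (0 : V) 1) ^ s * ENNReal.ofReal (r ^ (-(Module.finrank ℝ V * s))) *
        ENNReal.ofReal (2 ^ (Module.finrank ℝ V * s)) ^ m := by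
  have h2 : (0 : ℝ) < 2 ^ m / r := by positivity
  rw [Measure.addHaar_ball_of_pos _ _ h2, ENNReal.mul_rpow_of_nonneg _ _ hs,
    ENNReal.ofReal_rpow_of_nonneg (by positivity) hs, mul_comm, mul_assoc,
    ← ENNReal.ofReal_pow (by positivity), ← ENNReal.ofReal_mul (by positivity)]
  congr 2
  rw [← Real.rpow_natCast, ← Real.rpow_mul h2.le, Real.div_rpow (by positivity) hr.le,
    Real.rpow_neg hr.le, ← Real.rpow_natCast, ← Real.rpow_natCast, ← Real.rpow_mul two_pos.le,
    ← Real.rpow_mul two_pos.le, mul_comm (m : ℝ), div_eq_inv_mul]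

theorem integrable_schwartzMap_mul_kernel_mul (ψ : SchwartzMap V ℂ) (a : ℝ) {G : V → ℂ}
    (hG : Continuous G) {C : ℝ} (hC : ∀ x, ‖G x‖ ≤ C) (f : SchwartzMap V ℂ) (x : V) :
    Integrable fun y => ψ (a • (x - y)) * G (x - y) * f y := by
  have hψ := ψ.continuous
  refine f.integrable.bdd_mul (c := SchwartzMap.seminorm ℝ 0 0 ψ * C)
    (Continuous.aestronglyMeasurable (by fun_prop)) (ae_of_all _ fun y => ?_)
  rw [norm_mul]
  exact mul_le_mul (ψ.norm_le_seminorm ℝ _) (hC _) (norm_nonneg _) (apply_nonneg _ _)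

theorem tendsto_integral_dilated_cutoff_mul {χ : SchwartzMap V ℂ} (h0 : χ 0 = 1)
    (h1 : ∀ x, ‖χ x‖ ≤ 1) {G : V → ℂ} (hG : Continuous G) {C : ℝ} (hC : ∀ x, ‖G x‖ ≤ C)
    {ρ : ℕ → ℝ} (hρ : Tendsto ρ atTop atTop) (f : SchwartzMap V ℂ) (x : V) :
    Tendsto (fun n => ∫ y, χ ((ρ n)⁻¹ • (x - y)) * G (x - y) * f y) atTop
      (nhds (∫ y, G (x - y) * f y)) := by
  have hχ := χ.continuous
  have hf := f.continuous
  refine tendsto_integral_of_dominated_convergence (fun y => C * ‖f y‖)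
    (fun n => Continuous.aestronglyMeasurable (by fun_prop)) (f.integrable.norm.const_mul C)
    (fun n => ae_of_all _ fun y => ?_) (ae_of_all _ fun y => ?_)
  · rw [norm_mul, norm_mul]
    gcongr
    exact (mul_le_of_le_one_left (norm_nonneg _) (h1 _)).trans (hC _)
  · have h : Tendsto (fun n => χ ((ρ n)⁻¹ • (x - y))) atTop (nhds 1) := by
      rw [← h0]
      refine (hχ.tendsto 0).comp ?_
      simpa using (tendsto_inv_atTop_zero.comp hρ).smul_const (x - y)
    simpa using (h.mul_const (G (x - y))).mul_const (f y)

/-- The `L^p → L^q` bound for `η * μ` in scale-invariant form, with `R` the restriction constant. -/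
theorem exists_eLpNorm_convMeasure_multiplier_le (d : ℕ) {p q : ℝ} (hp : 1 ≤ p) (hpq : p ≤ q)
    (hq : q ≤ 2) (N : ℕ) (hN : (d : ℝ) * (1 / q - 1 / 2) < N) :
    ∃ T : ℝ≥0∞, T ≠ ∞ ∧
      ∀ (μ : Measure (EuclideanSpace ℝ (Fin d))) [IsFiniteMeasure μ] (R : ℝ≥0∞),
      (∀ u : SchwartzMap (EuclideanSpace ℝ (Fin d)) ℂ,
        ∫⁻ ξ, ‖𝓕 (u : EuclideanSpace ℝ (Fin d) → ℂ) ξ‖ₑ ^ 2 ∂μ ≤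
          (R * eLpNorm u (ENNReal.ofReal p) volume) ^ 2) →
      ∀ r : ℝ, 0 < r → ∀ η : EuclideanSpace ℝ (Fin d) → ℂ, ContDiff ℝ (⊤ : ℕ∞) η →
      (∀ ξ ∈ tsupport η, ‖ξ‖ ≤ r) →
      (∀ k : ℕ, k ≤ N → ∀ ξ, r ^ k * ‖iteratedFDeriv ℝ k η ξ‖ ≤ 1) →
      ∀ f : SchwartzMap (EuclideanSpace ℝ (Fin d)) ℂ,
        eLpNorm (𝓕⁻ (fun ξ => convMeasure η μ ξ * 𝓕 (f : EuclideanSpace ℝ (Fin d) → ℂ) ξ))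
          (ENNReal.ofReal q) volume ≤
          T * (ENNReal.ofReal (r ^ (-(d * (1 / q - 1 / 2)))) *
            (((⨆ x, μ (Metric.closedBall x r)) * volume (Metric.closedBall
              (0 : EuclideanSpace ℝ (Fin d)) r)) ^ (1 / 2 : ℝ) * R) *
            eLpNorm f (ENNReal.ofReal p) volume) := by
  obtain ⟨χ, ψ, hχ1, hχn, hχ0, hψ0, hχψ⟩ := exists_schwartzMap_cutoff d N
  have hq0 : 0 < q := by linarith
  set s := 1 / q - 1 / 2 with hs
  have hs0 : 0 ≤ s := sub_nonneg.2 (one_div_le_one_div_of_le hq0 hq)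
  set τ := ENNReal.ofReal (2 ^ (d * s)) with hτ
  set κ := ENNReal.ofReal ((2 ^ N)⁻¹) with hκ
  have hθ : τ * κ < 1 := by
    rw [hτ, hκ, ← ENNReal.ofReal_mul (by positivity), ENNReal.ofReal_lt_one, ← div_eq_mul_inv,
      div_lt_one (by positivity), ← Real.rpow_natCast]
    exact Real.rpow_lt_rpow_of_exponent_lt one_lt_two hN
  set X₀ := ∫⁻ ζ, ‖𝓕 χ ζ‖ₑ
  set X := ∑ j, ∫⁻ ζ, ‖𝓕 (ψ j) ζ‖ₑ with hX
  set ω := volume (Metric.ball (0 : EuclideanSpace ℝ (Fin d)) 1)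
  refine ⟨4 ^ d * ω ^ s * (X₀ + X * (1 - τ * κ)⁻¹), ?_, ?_⟩
  · have h₀ : X₀ ≠ ∞ := (𝓕 χ).integrable.hasFiniteIntegral.ne
    have h₁ : X ≠ ∞ := ENNReal.sum_ne_top.2 fun j _ => (𝓕 (ψ j)).integrable.hasFiniteIntegral.ne
    refine ENNReal.mul_ne_top (ENNReal.mul_ne_top (by finiteness)
      (ENNReal.rpow_ne_top_of_nonneg hs0 measure_ball_lt_top.ne))
      (ENNReal.add_ne_top.2 ⟨h₀, ENNReal.mul_ne_top h₁ ?_⟩)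
    exact ENNReal.inv_ne_top.2 (tsub_pos_of_lt hθ).ne'
  intro μ _ R hR r hr η hη hsupp hder f
  set Q := ((⨆ x, μ (Metric.closedBall x r)) * volume (Metric.closedBall
    (0 : EuclideanSpace ℝ (Fin d)) r)) ^ (1 / 2 : ℝ)
  set Nf := eLpNorm f (ENNReal.ofReal p) volume
  have hsupp' (ξ) (hξ : r < ‖ξ‖) : ξ ∉ tsupport η := fun h => (hsupp ξ h).not_gt hξ
  have hηc : HasCompactSupport η :=
    HasCompactSupport.intro (isCompact_closedBall 0 r) fun ξ hξ =>
      image_eq_zero_of_notMem_tsupport (hsupp' ξ (by simpa using hξ))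
  have hηi : Integrable η := hη.continuous.integrable_of_hasCompactSupport hηc
  set K := 𝓕⁻ (convMeasure η μ) with hK
  have hKc : Continuous K := continuous_fourierInv_of_integrable (integrable_convMeasure μ hηi)
  have hKb : ∀ x, ‖K x‖ ≤ _ := norm_fourierInv_le_integral_norm (convMeasure η μ)
  set P : ℕ → EuclideanSpace ℝ (Fin d) → ℂ :=
    fun n x => ∫ y, χ ((2 ^ n / r)⁻¹ • (x - y)) * K (x - y) * f y with hP
  have hPm (n : ℕ) : StronglyMeasurable (P n) :=
    stronglyMeasurable_integral_kernel_mul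
      (k := fun z => χ ((2 ^ n / r)⁻¹ • z) * K z)
      ((χ.continuous.comp (continuous_const_smul _)).mul hKc) f
  set L := ENNReal.ofReal (r ^ (-(d * s))) * (Q * R) * Nf with hL
  have hq1 : 1 ≤ ENNReal.ofReal q := by
    rw [ENNReal.one_le_ofReal]
    linarith
  have hzero : eLpNorm (P 0) (ENNReal.ofReal q) volume ≤ 4 ^ d * ω ^ s * X₀ * L := by
    have h := eLpNorm_schwartzMap_mul_convMeasure_multiplier_le hp hpq hq μ hR hηi
      (M := 1) ENNReal.one_ne_top (fun ξ => ?_)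
      (fun ξ hξ => image_eq_zero_of_notMem_tsupport (hsupp' ξ hξ)) χ hχ0
      (ρ := 2 ^ 0 / r) (by positivity) f
    · refine h.trans_eq ?_
      rw [volume_ball_two_pow_div_rpow hr hs0, finrank_euclideanSpace_fin, hL]
      ring
    · have := hder 0 N.zero_le ξ
      rw [pow_zero, one_mul, norm_iteratedFDeriv_zero] at this
      rw [← ofReal_norm]
      exact ENNReal.ofReal_le_one.2 this
  have hstep (n : ℕ) : eLpNorm (P (n + 1) - P n) (ENNReal.ofReal q) volume ≤
      4 ^ d * ω ^ s * (X * (τ * κ) ^ (n + 1)) * L := by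
    set ρ : ℝ := 2 ^ (n + 1) / r with hρ
    have hρ0 : 0 < ρ := by positivity
    have hρn : ((2 : ℝ) ^ n / r)⁻¹ = 2 * ρ⁻¹ := by
      rw [hρ]
      field_simp
      ring
    have hρr : (ρ⁻¹) ^ N * (r ^ N)⁻¹ = ((2 ^ N)⁻¹) ^ (n + 1) := by
      rw [hρ, inv_div, div_pow, ← pow_mul, mul_comm _ N, pow_mul, inv_pow]
      field_simp
    choose g hgi hgn hgf using fun j : Fin d =>
      exists_fourierInv_eq_inner_pow_mul hη hηc N
        (e := EuclideanSpace.single j (1 : ℝ)) (by simp) ((ρ⁻¹) ^ N)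
    have hgK (j : Fin d) (z) : 𝓕⁻ (convMeasure (g j) μ) z =
        (((ρ⁻¹ • z) j : ℝ) : ℂ) ^ N * K z := by
      rw [hK, fourierInv_convMeasure μ (hgi j), fourierInv_convMeasure μ hηi, hgf,
        EuclideanSpace.inner_single_right]
      simp only [PiLp.smul_apply, smul_eq_mul, Complex.ofReal_mul, Complex.ofReal_pow, mul_pow,
        conj_trivial, one_mul]
      ring
    have hdiff : P (n + 1) - P n =
        ∑ j, fun x => ∫ y, ψ j (ρ⁻¹ • (x - y)) * 𝓕⁻ (convMeasure (g j) μ) (x - y) * f y := by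
      ext x
      rw [Pi.sub_apply, Finset.sum_apply, ← integral_finsetSum, hP]
      · simp only
        rw [← integral_sub (integrable_schwartzMap_mul_kernel_mul χ _ hKc hKb f x)
          (integrable_schwartzMap_mul_kernel_mul χ _ hKc hKb f x)]
        congr 1
        ext y
        rw [hρn, mul_smul, ← hρ, ← sub_mul, ← sub_mul, hχψ, Finset.sum_mul, Finset.sum_mul]
        refine Finset.sum_congr rfl fun j _ => ?_
        rw [hgK, mul_assoc (ψ j _)]
      · intro j _
        exact integrable_schwartzMap_mul_kernel_mul (ψ j) _
          (continuous_fourierInv_of_integrable (integrable_convMeasure μ (hgi j)))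
          (norm_fourierInv_le_integral_norm _) f x
    have hpiece (j : Fin d) : eLpNorm (fun x => ∫ y, ψ j (ρ⁻¹ • (x - y)) *
        𝓕⁻ (convMeasure (g j) μ) (x - y) * f y) (ENNReal.ofReal q) volume ≤
        4 ^ d * ω ^ s * ((∫⁻ ζ, ‖𝓕 (ψ j) ζ‖ₑ) * (τ * κ) ^ (n + 1)) * L := by
      have h := eLpNorm_schwartzMap_mul_convMeasure_multiplier_le hp hpq hq μ hR (hgi j)
        (M := κ ^ (n + 1)) (r := r) (by finiteness) (fun ξ => ?_) (fun ξ hξ => ?_)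
        (ψ j) (hψ0 j) hρ0 f
      · refine h.trans_eq ?_
        rw [hρ, volume_ball_two_pow_div_rpow hr hs0, finrank_euclideanSpace_fin, hL]
        ring
      · rw [hκ, ← ENNReal.ofReal_pow (by positivity), ← hρr, ← ofReal_norm]
        refine ENNReal.ofReal_le_ofReal ((hgn j ξ).trans ?_)
        rw [abs_of_nonneg (by positivity)]
        gcongr
        rw [← one_div, le_div_iff₀' (by positivity)]
        exact hder N le_rfl ξ
      · have h0 : iteratedFDeriv ℝ N η ξ = 0 := by
          by_contra h
          exact hsupp' ξ hξ (support_iteratedFDeriv_subset N h)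
        simpa [h0] using hgn j ξ
    rw [hdiff]
    refine (eLpNorm_sum_le (fun j _ => ?_) hq1).trans ?_
    · exact (stronglyMeasurable_integral_kernel_mul
        (k := fun z => ψ j (ρ⁻¹ • z) * 𝓕⁻ (convMeasure (g j) μ) z)
        (((ψ j).continuous.comp (continuous_const_smul _)).mul
          (continuous_fourierInv_of_integrable (integrable_convMeasure μ (hgi j))))
        f).aestronglyMeasurable
    · refine (Finset.sum_le_sum fun j _ => hpiece j).trans_eq ?_
      rw [hX, Finset.sum_mul, Finset.mul_sum, Finset.sum_mul]
  have hsum (n : ℕ) : eLpNorm (P n) (ENNReal.ofReal q) volume ≤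
      4 ^ d * ω ^ s * (X₀ + X * ∑ m ∈ Finset.range (n + 1), (τ * κ) ^ m) * L := by
    induction n with
    | zero =>
      refine hzero.trans ?_
      gcongr
      exact le_self_add
    | succ n ih =>
      calc _ = eLpNorm (P n + (P (n + 1) - P n)) (ENNReal.ofReal q) volume := by
            rw [add_sub_cancel]
        _ ≤ _ := eLpNorm_add_le (hPm n).aestronglyMeasurable
            ((hPm (n + 1)).sub (hPm n)).aestronglyMeasurable hq1
        _ ≤ _ := add_le_add ih (hstep n)
        _ = _ := by
          rw [Finset.sum_range_succ _ (n + 1)]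
          ring
  have hrep : 𝓕⁻ (fun ξ => convMeasure η μ ξ * 𝓕 (f : EuclideanSpace ℝ (Fin d) → ℂ) ξ) =
      fun x => ∫ y, K (x - y) * f y := by
    ext x
    exact fourierInv_mul_fourier_eq_integral (integrable_convMeasure μ hηi) f.integrable x
  rw [hrep]
  refine Lp.eLpNorm_le_of_ae_tendsto (u := atTop) (f := P) (Eventually.of_forall fun n => ?_)
    (fun n => (hPm n).aestronglyMeasurable) (ae_of_all _ fun x => ?_)
  · refine (hsum n).trans ?_
    gcongr
    rw [← ENNReal.tsum_geometric]
    exact ENNReal.sum_le_tsum _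
  · refine tendsto_integral_dilated_cutoff_mul (hχ1 0 (by simp)) hχn hKc hKb ?_ f x
    exact (tendsto_pow_atTop_atTop_of_one_lt one_lt_two).atTop_div_const hr

theorem lintegral_enorm_sq_fourier_le_of_restriction (μ : Measure V) [IsFiniteMeasure μ]
    {p : ℝ≥0∞} {A : ℝ} (u : SchwartzMap V ℂ)
    (hA : (∫ ξ, ‖𝓕 (u : V → ℂ) ξ‖ ^ 2 ∂μ) ^ ((1 : ℝ) / 2) ≤ A * (eLpNorm u p volume).toReal) :
    ∫⁻ ξ, ‖𝓕 (u : V → ℂ) ξ‖ₑ ^ 2 ∂μ ≤ (ENNReal.ofReal |A| * eLpNorm u p volume) ^ 2 := by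
  have hF : 𝓕 (u : V → ℂ) = ((𝓕 u : SchwartzMap V ℂ) : V → ℂ) := (SchwartzMap.fourier_coe u).symm
  have hi : Integrable (fun ξ => ‖𝓕 (u : V → ℂ) ξ‖ ^ 2) μ := by
    have hc := (𝓕 u).continuous
    rw [hF]
    refine Integrable.of_bound (C := SchwartzMap.seminorm ℝ 0 0 (𝓕 u) ^ 2)
      (Continuous.aestronglyMeasurable (by fun_prop)) (ae_of_all _ fun ξ => ?_)
    rw [norm_pow, norm_norm]
    gcongr
    exact (𝓕 u).norm_le_seminorm ℝ ξ
  have h0 : 0 ≤ ∫ ξ, ‖𝓕 (u : V → ℂ) ξ‖ ^ 2 ∂μ := integral_nonneg fun _ => by positivity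
  have h1 : ∫⁻ ξ, ‖𝓕 (u : V → ℂ) ξ‖ₑ ^ 2 ∂μ =
      ENNReal.ofReal (∫ ξ, ‖𝓕 (u : V → ℂ) ξ‖ ^ 2 ∂μ) := by
    rw [ofReal_integral_eq_lintegral_ofReal hi (ae_of_all _ fun _ => by positivity)]
    simp only [ENNReal.ofReal_pow (norm_nonneg _), ofReal_norm]
  rw [← Real.sqrt_eq_rpow] at hA
  have h2 := hA.trans (mul_le_mul_of_nonneg_right (le_abs_self A) ENNReal.toReal_nonneg)
  rw [h1, ← ENNReal.ofReal_toReal (u.eLpNorm_lt_top p volume).ne,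
    ← ENNReal.ofReal_mul (abs_nonneg A), ← ENNReal.ofReal_pow (by positivity)]
  exact ENNReal.ofReal_le_ofReal ((Real.sqrt_le_left (by positivity)).1 h2)

end Fourier

/-- Single-scale multiplier estimate of Bochner–Riesz type: if the `L^p → L²(μ)` restriction
inequality holds with constant `A` and `h = η * μ` with `η` an adapted bump on the annulus
of size `r`, then convolution with `ℱ^{−1}h` maps `L^p → L^q` with norm
`≲ r^{d−d/q} A ϖ(r)^{1/2}`. -/
theorem single_scale_multiplier (d : ℕ) (hd : 1 ≤ d) (p q : ℝ) (hp : 1 ≤ p) (hpq : p ≤ q)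
    (hq : q ≤ 2) (N : ℕ) (hN : (d : ℝ) * (1 / q - 1 / 2) < N) :
    ∃ C : ℝ, 0 < C ∧
      ∀ μ : Measure (EuclideanSpace ℝ (Fin d)), IsProbabilityMeasure μ →
      ∀ A : ℝ,
        (∀ f : SchwartzMap (EuclideanSpace ℝ (Fin d)) ℂ,
          (∫ ξ, ‖𝓕 (⇑f) ξ‖ ^ 2 ∂μ) ^ ((1:ℝ)/2) ≤
            A * (eLpNorm (⇑f) (ENNReal.ofReal p) volume).toReal) →
      ∀ r : ℝ, 0 < r → r ≤ 1 →
      ∀ η : EuclideanSpace ℝ (Fin d) → ℂ, ContDiff ℝ (⊤ : ℕ∞) η →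
        (tsupport η ⊆ {ξ | r / 4 ≤ ‖ξ‖ ∧ ‖ξ‖ ≤ r}) →
        (∀ k : ℕ, k ≤ N → ∀ ξ, r ^ k * ‖iteratedFDeriv ℝ k η ξ‖ ≤ 1) →
      ∀ f : SchwartzMap (EuclideanSpace ℝ (Fin d)) ℂ,
        eLpNorm (𝓕⁻ (fun ξ => (∫ w, η (ξ - w) ∂μ) * 𝓕 (⇑f) ξ)) (ENNReal.ofReal q) volume ≤
          ENNReal.ofReal (C * r ^ ((d : ℝ) - d / q) * A *
            ((⨆ x, μ (Metric.closedBall x r)).toReal) ^ ((1:ℝ)/2) *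
            (eLpNorm (⇑f) (ENNReal.ofReal p) volume).toReal) := by
  obtain ⟨T, hT, hbound⟩ := exists_eLpNorm_convMeasure_multiplier_le d hp hpq hq N hN
  set ω := volume (Metric.ball (0 : EuclideanSpace ℝ (Fin d)) 1)
  have hTω : T * ω ^ (1 / 2 : ℝ) ≠ ∞ :=
    ENNReal.mul_ne_top hT (ENNReal.rpow_ne_top_of_nonneg (by norm_num) measure_ball_lt_top.ne)
  refine ⟨(T * ω ^ (1 / 2 : ℝ)).toReal + 1, by positivity, ?_⟩
  intro μ _ A hA r hr _ η hη hsupp hder f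
  set W := ⨆ x, μ (Metric.closedBall x r)
  set Nf := eLpNorm f (ENNReal.ofReal p) volume
  have hW : W ≠ ∞ := ((iSup_le fun _ => prob_le_one).trans_lt ENNReal.one_lt_top).ne
  have hNf : Nf ≠ ∞ := (f.eLpNorm_lt_top (ENNReal.ofReal p) volume).ne
  have habs : A * Nf.toReal = |A| * Nf.toReal := by
    rw [← abs_of_nonneg (ENNReal.toReal_nonneg (a := Nf)), ← abs_mul,
      abs_of_nonneg (ENNReal.toReal_nonneg (a := Nf)), abs_of_nonneg]
    exact (Real.rpow_nonneg (integral_nonneg fun _ => by positivity) _).trans (hA f)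
  have hvol : volume (Metric.closedBall (0 : EuclideanSpace ℝ (Fin d)) r) ^ (1 / 2 : ℝ) =
      ENNReal.ofReal (r ^ ((d : ℝ) / 2)) * ω ^ (1 / 2 : ℝ) := by
    rw [Measure.addHaar_closedBall _ _ hr.le, finrank_euclideanSpace_fin,
      ENNReal.mul_rpow_of_nonneg _ _ (by norm_num),
      ENNReal.ofReal_rpow_of_nonneg (by positivity) (by norm_num), ← Real.rpow_natCast,
      ← Real.rpow_mul hr.le, mul_one_div]
  have hexp : ENNReal.ofReal (r ^ (-(d * (1 / q - 1 / 2)))) * ENNReal.ofReal (r ^ ((d : ℝ) / 2)) =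
      ENNReal.ofReal (r ^ ((d : ℝ) - d / q)) := by
    rw [← ENNReal.ofReal_mul (by positivity), ← Real.rpow_add hr]
    congr 2
    ring
  have hC : T * ω ^ (1 / 2 : ℝ) ≤ ENNReal.ofReal ((T * ω ^ (1 / 2 : ℝ)).toReal + 1) :=
    ENNReal.le_ofReal_iff_toReal_le hTω (by positivity) |>.2 (by linarith)
  calc _ ≤ _ := hbound μ (ENNReal.ofReal |A|)
        (fun u => lintegral_enorm_sq_fourier_le_of_restriction μ u (hA u)) r hr η hη
        (fun ξ hξ => (hsupp hξ).2) hder f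
    _ = T * ω ^ (1 / 2 : ℝ) * ENNReal.ofReal (r ^ ((d : ℝ) - d / q)) * ENNReal.ofReal |A| *
          W ^ (1 / 2 : ℝ) * Nf := by
      rw [ENNReal.mul_rpow_of_nonneg _ _ (by norm_num), hvol, ← hexp]
      ring
    _ ≤ ENNReal.ofReal ((T * ω ^ (1 / 2 : ℝ)).toReal + 1) *
          ENNReal.ofReal (r ^ ((d : ℝ) - d / q)) * ENNReal.ofReal |A| *
          W ^ (1 / 2 : ℝ) * Nf := by
      gcongr
    _ = _ := by
      rw [mul_assoc (_ * A), mul_comm (_ ^ _) Nf.toReal, ← mul_assoc, mul_assoc _ A, habs,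
        ENNReal.ofReal_mul (by positivity), ENNReal.ofReal_mul (by positivity),
        ENNReal.ofReal_mul (by positivity), ENNReal.ofReal_mul (by positivity),
        ENNReal.ofReal_toReal hNf,
        ← ENNReal.ofReal_rpow_of_nonneg (x := W.toReal) (by positivity) (by norm_num),
        ENNReal.ofReal_toReal hW]
      ring
end
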